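/- arXiv:2005.09545 — 4 statements merged into one kernel-verified Lean document; each statement's English description precedes it below -/
import Mathlib

section
/- In the third exterior power (over ℂ) of the Laurent polynomial ring Λ = ℂ[t,t⁻¹], let N be the ℂ-subspace spanned by all elements of the form u ∧ v ∧ w − (tⁿ·u) ∧ (tⁿ·v) ∧ (tⁿ·w) for u, v, w ∈ Λ and n ∈ ℤ. Then the images of the elements 1 ∧ t ∧ t^p, for integers p ≥ 3, are linearly independent over ℂ in the quotient vector space (⋀³_ℂ Λ)/N; in particular this quotient contains a ℂ-subspace of countably infinite dimension. -/
open LaurentPolynomial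

noncomputable section

/-- `Λ = ℂ[t,t⁻¹]`, the ring of Laurent polynomials over `ℂ`. -/
abbrev Λ : Type := LaurentPolynomial ℂ

/-- The wedge `u ∧ v ∧ w` of three elements of `Λ`, as an element of the third
exterior power `⋀³_ℂ Λ`. -/
def wedge3 (u v w : Λ) : ⋀[ℂ]^3 Λ :=
  ⟨ExteriorAlgebra.ιMulti ℂ 3 ![u, v, w],
    ExteriorAlgebra.ιMulti_range ℂ 3 (Set.mem_range_self _)⟩

/-- The subspace `N` of `⋀³_ℂ Λ` spanned by the elements
`u ∧ v ∧ w − (tⁿ·u) ∧ (tⁿ·v) ∧ (tⁿ·w)`. -/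
def relN : Submodule ℂ (⋀[ℂ]^3 Λ) :=
  Submodule.span ℂ
    {x | ∃ (u v w : Λ) (n : ℤ),
      x = wedge3 u v w - wedge3 (T n * u) (T n * v) (T n * w)}

/-- The values of the coefficients of `u` in the degrees `k`, `k + 1` and `k + p`. -/
def coeffTriple (p k : ℤ) : Λ →ₗ[ℂ] (Fin 3 → ℂ) where
  toFun u i := u.coeff (k + ![0, 1, p] i)
  map_add' _ _ := by ext; simp
  map_smul' _ _ := by ext; simp

lemma coeffTriple_T_mul (p k n : ℤ) (u : Λ) :
    coeffTriple p k (T n * u) = coeffTriple p (k - n) u := by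
  ext i
  simp only [coeffTriple, LinearMap.coe_mk, AddHom.coe_mk, T,
    AddMonoidAlgebra.coeff_single_mul_apply, one_mul]
  congr 1
  ring

/-- The determinant of the coefficients of three Laurent polynomials in the degrees
`k`, `k + 1` and `k + p`. -/
def coeffDet (p k : ℤ) : Λ [⋀^Fin 3]→ₗ[ℂ] ℂ :=
  Matrix.detRowAlternating.compLinearMap (coeffTriple p k)

lemma coeffDet_apply (p k : ℤ) (v : Fin 3 → Λ) :
    coeffDet p k v = (Matrix.of fun i => coeffTriple p k (v i)).det := rfl

lemma coeffDet_T_mul (p k n : ℤ) (v : Fin 3 → Λ) :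
    coeffDet p k (fun i => T n * v i) = coeffDet p (k - n) v := by
  simp only [coeffDet_apply, coeffTriple_T_mul]

lemma finite_support_coeffDet (p : ℤ) (v : Fin 3 → Λ) :
    (Function.support fun k => coeffDet p k v).Finite := by
  refine (Set.finite_iUnion fun j => (v j).coeff.support.finite_toSet).subset fun k hk => ?_
  by_contra h
  refine hk ((coeffDet_apply p k v).trans (Matrix.det_eq_zero_of_column_eq_zero 0 fun j => ?_))
  simp only [Set.mem_iUnion, Finset.mem_coe, Finsupp.mem_support_iff, not_exists, not_not] at h
  simpa [coeffTriple] using h j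

/-- The sum over all `k` of the determinants `coeffDet p k`, as a translation-invariant
alternating form. -/
def shiftDet (p : ℤ) : Λ [⋀^Fin 3]→ₗ[ℂ] ℂ where
  toFun v := ∑ᶠ k, coeffDet p k v
  map_update_add' v i x y := by
    classical
    rw [← finsum_add_distrib (finite_support_coeffDet p _) (finite_support_coeffDet p _)]
    refine finsum_congr fun k => ?_
    convert (coeffDet p k).map_update_add v i x y
  map_update_smul' v i c x := by
    classical
    rw [smul_finsum' c (finite_support_coeffDet p _)]
    refine finsum_congr fun k => ?_
    convert (coeffDet p k).map_update_smul v i c x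
  map_eq_zero_of_eq' v i j h hij :=
    finsum_eq_zero_of_forall_eq_zero fun k => (coeffDet p k).map_eq_zero_of_eq v h hij

lemma shiftDet_apply (p : ℤ) (v : Fin 3 → Λ) : shiftDet p v = ∑ᶠ k, coeffDet p k v := rfl

lemma shiftDet_T_mul (p n : ℤ) (v : Fin 3 → Λ) :
    shiftDet p (fun i => T n * v i) = shiftDet p v := by
  simp only [shiftDet_apply, coeffDet_T_mul]
  exact finsum_comp_equiv (Equiv.subRight n) (f := fun k => coeffDet p k v)

lemma coeffDet_one_T_T {p q : ℤ} (hp : 3 ≤ p) (hq : 3 ≤ q) (k : ℤ) :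
    coeffDet p k ![1, T 1, T q] = if k = 0 ∧ p = q then 1 else 0 := by
  rw [← T_zero, coeffDet_apply, Matrix.det_fin_three]
  simp only [coeffTriple, LinearMap.coe_mk, AddHom.coe_mk, Matrix.of_apply, Matrix.cons_val, T_apply]
  split_ifs <;> first | omega | norm_num

lemma shiftDet_one_T_T {p q : ℤ} (hp : 3 ≤ p) (hq : 3 ≤ q) :
    shiftDet p ![1, T 1, T q] = if p = q then 1 else 0 := by
  rw [shiftDet_apply, finsum_eq_single _ 0 fun k hk => by
    simp [coeffDet_one_T_T hp hq, hk], coeffDet_one_T_T hp hq]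
  simp

/-- The linear form on `⋀³_ℂ Λ` induced by `shiftDet p`. -/
def shiftDetLinear (p : ℤ) : ⋀[ℂ]^3 Λ →ₗ[ℂ] ℂ :=
  exteriorPower.alternatingMapLinearEquiv (shiftDet p)

lemma shiftDetLinear_wedge3 (p : ℤ) (u v w : Λ) :
    shiftDetLinear p (wedge3 u v w) = shiftDet p ![u, v, w] :=
  exteriorPower.alternatingMapLinearEquiv_apply_ιMulti (shiftDet p) ![u, v, w]

lemma relN_le_ker_shiftDetLinear (p : ℤ) : relN ≤ LinearMap.ker (shiftDetLinear p) := by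
  refine Submodule.span_le.2 ?_
  rintro _ ⟨u, v, w, n, rfl⟩
  have h := shiftDet_T_mul p n ![u, v, w]
  rw [show (fun i => T n * ![u, v, w] i) = ![T n * u, T n * v, T n * w] by
    ext i : 1; fin_cases i <;> rfl] at h
  simp only [SetLike.mem_coe, LinearMap.mem_ker, map_sub, shiftDetLinear_wedge3, h, sub_self]

lemma linearIndependent_mk_wedge3 :
    LinearIndependent ℂ (fun p : {p : ℤ // 3 ≤ p} =>
      Submodule.Quotient.mk (p := relN) (wedge3 1 (T 1) (T p.1))) := by
  have key (p q : {p : ℤ // 3 ≤ p}) :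
      relN.liftQ (shiftDetLinear p) (relN_le_ker_shiftDetLinear p)
        (Submodule.Quotient.mk (wedge3 1 (T 1) (T q.1))) = if p = q then 1 else 0 := by
    simp [shiftDetLinear_wedge3, shiftDet_one_T_T p.2 q.2, Subtype.ext_iff]
  exact LinearIndependent.of_pairwise_dual_eq_zero_one _
    (fun p => relN.liftQ (shiftDetLinear p) (relN_le_ker_shiftDetLinear p))
    (fun p q hpq => (key p q).trans (if_neg hpq)) (fun p => (key p p).trans (if_pos rfl))

/-- The images of `1 ∧ t ∧ t^p` (for integers `p ≥ 3`) in `(⋀³_ℂ Λ)/N` are linearly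
independent over `ℂ`; in particular this quotient contains a `ℂ`-subspace of countably
infinite dimension. -/
theorem theta_classes_linearIndependent :
    LinearIndependent ℂ
      (fun p : {p : ℤ // 3 ≤ p} =>
        Submodule.Quotient.mk (p := relN) (wedge3 1 (T 1) (T p.1))) ∧
    ∃ V : Submodule ℂ ((⋀[ℂ]^3 Λ) ⧸ relN), Module.rank ℂ V = Cardinal.aleph0 := by
  refine ⟨linearIndependent_mk_wedge3, Submodule.span ℂ (Set.range _),
    (rank_span linearIndependent_mk_wedge3).trans ?_⟩
  rw [Cardinal.mk_range_eq _ linearIndependent_mk_wedge3.injective]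
  have : Infinite {p : ℤ // 3 ≤ p} := (Set.Ici_infinite (3 : ℤ)).to_subtype
  exact Cardinal.mk_eq_aleph0 _

end
end

section
/- Let (e₀, e₁, e₂) be a ℂ-basis of 𝔰𝔩₂(ℂ) and let (f₀, f₁, f₂) be elements of 𝔰𝔩₂(ℂ) satisfying Tr(eᵢ·fⱼ) = δᵢⱼ (the dual basis with respect to the trace form). Let x and y be invertible 2×2 complex matrices. Then Σ_{i,j,k} Tr( [eᵢ, x·eⱼ·x⁻¹] · (y·e_k·y⁻¹) ) · Tr( [f_k, fⱼ] · fᵢ ) = 2·( τ(x)·τ(y) − τ(x·y) ), where [A,B] = AB − BA and τ(g) = Tr(g)·Tr(g⁻¹) − 1. -/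
noncomputable section

/-- Expansion of the trace-free part of `A` in a spanning family of trace-free matrices that has
a trace-dual family. -/
theorem sum_trace_mul_smul_of_dual
    {e f : Fin 3 → Matrix (Fin 2) (Fin 2) ℂ} (hf : ∀ i, (f i).trace = 0)
    (hspan : ∀ X : Matrix (Fin 2) (Fin 2) ℂ, X.trace = 0 → X ∈ Submodule.span ℂ (Set.range e))
    (hdual : ∀ i j, (e i * f j).trace = if i = j then 1 else 0)
    (A : Matrix (Fin 2) (Fin 2) ℂ) :
    ∑ i, (A * f i).trace • e i = A - (A.trace / 2) • 1 := by
  have hA : (A - (A.trace / 2) • (1 : Matrix (Fin 2) (Fin 2) ℂ)).trace = 0 := by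
    simp
  obtain ⟨c, hc⟩ := (Submodule.mem_span_range_iff_exists_fun ℂ).1 (hspan _ hA)
  rw [← hc]
  refine Finset.sum_congr rfl fun j _ => ?_
  congr 1
  have h := congrArg (fun M => (M * f j).trace) hc
  simpa [Finset.sum_mul, Matrix.trace_sum, hdual, sub_mul, hf, eq_comm] using h

/-- Contraction of two traces along the Casimir element of `𝔰𝔩₂`. -/
theorem sum_trace_mul_trace_of_dual
    {e f : Fin 3 → Matrix (Fin 2) (Fin 2) ℂ} (hf : ∀ i, (f i).trace = 0)
    (hspan : ∀ X : Matrix (Fin 2) (Fin 2) ℂ, X.trace = 0 → X ∈ Submodule.span ℂ (Set.range e))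
    (hdual : ∀ i j, (e i * f j).trace = if i = j then 1 else 0)
    (A B : Matrix (Fin 2) (Fin 2) ℂ) :
    ∑ i, (e i * A).trace * (f i * B).trace = (A * B).trace - A.trace * B.trace / 2 := by
  have h := congrArg (fun M => (M * A).trace) (sum_trace_mul_smul_of_dual hf hspan hdual B)
  simp only [Finset.sum_mul, Matrix.trace_sum, sub_mul, Matrix.trace_sub, smul_mul_assoc, one_mul,
    Matrix.trace_smul, smul_eq_mul] at h
  simp only [Matrix.trace_mul_comm (f _) B, Matrix.trace_mul_comm A B, mul_comm (e _ * A).trace, h]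
  ring

/-- Contraction inside one trace along the Casimir element of `𝔰𝔩₂`. -/
theorem sum_trace_mul_mul_mul_of_dual
    {e f : Fin 3 → Matrix (Fin 2) (Fin 2) ℂ} (hf : ∀ i, (f i).trace = 0)
    (hspan : ∀ X : Matrix (Fin 2) (Fin 2) ℂ, X.trace = 0 → X ∈ Submodule.span ℂ (Set.range e))
    (hdual : ∀ i j, (e i * f j).trace = if i = j then 1 else 0)
    (A B : Matrix (Fin 2) (Fin 2) ℂ) :
    ∑ i, (e i * A * f i * B).trace = A.trace * B.trace - (A * B).trace / 2 := by
  have h (a b c d : Fin 2) : ∑ i, e i a b * f i c d =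
      (Matrix.single d c 1 - ((Matrix.single d c (1 : ℂ)).trace / 2) • 1 :
        Matrix (Fin 2) (Fin 2) ℂ) a b := by
    rw [← sum_trace_mul_smul_of_dual hf hspan hdual, Matrix.sum_apply]
    refine Finset.sum_congr rfl fun i _ => ?_
    simp [Matrix.trace_single_mul, mul_comm]
  have key : ∑ i, (e i * A * f i * B).trace =
      ∑ a, ∑ b, ∑ c, ∑ d, (∑ i, e i a b * f i c d) * (A b c * B d a) := by
    simp only [Matrix.trace_fin_two, Matrix.mul_apply, Fin.sum_univ_two, Fin.sum_univ_three]
    ring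
  rw [key]
  simp only [h]
  simp [Fin.sum_univ_two, Matrix.trace_fin_two, Matrix.mul_apply, Matrix.single_apply,
    Matrix.one_apply]
  ring

/-- A trace identity for two invertible 2×2 matrices. -/
theorem trace_mul_trace_inv_sub_trace_commutator (x y : Matrix (Fin 2) (Fin 2) ℂ)
    (hx : IsUnit x) (hy : IsUnit y) :
    (y⁻¹).trace * (x.trace * (x⁻¹ * y).trace) + y.trace * ((x⁻¹).trace * (y⁻¹ * x).trace)
        - (x⁻¹ * y * x * y⁻¹).trace - (x⁻¹ * y⁻¹ * x * y).trace =
      2 * ((x.trace * (x⁻¹).trace - 1) * (y.trace * (y⁻¹).trace - 1) -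
            ((x * y).trace * ((x * y)⁻¹).trace - 1)) := by
  have hx' := ((Matrix.isUnit_iff_isUnit_det x).1 hx).ne_zero
  have hy' := ((Matrix.isUnit_iff_isUnit_det y).1 hy).ne_zero
  rw [Matrix.mul_inv_rev]
  simp only [Matrix.inv_def, Ring.inverse_eq_inv', Matrix.adjugate_fin_two]
  simp only [Matrix.det_fin_two] at hx' hy' ⊢
  simp only [Matrix.trace_fin_two, Matrix.mul_apply, Fin.sum_univ_two, Matrix.smul_apply,
    smul_eq_mul, Matrix.of_apply, Matrix.cons_val', Matrix.cons_val_zero, Matrix.cons_val_one,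
    Matrix.cons_val_fin_one]
  field_simp
  ring

/-- The `𝔰𝔩₂`-weight of the Θ-graph: if `(e₀,e₁,e₂)` is a basis of `𝔰𝔩₂(ℂ)` (trace-zero
2×2 complex matrices) and `(f₀,f₁,f₂)` its dual basis with respect to the trace form,
then for invertible `x, y`,
`Σ_{i,j,k} Tr([eᵢ, x·eⱼ·x⁻¹]·(y·e_k·y⁻¹))·Tr([f_k, fⱼ]·fᵢ) = 2·(τ(x)·τ(y) − τ(x·y))`,
where `τ(g) = Tr(g)·Tr(g⁻¹) − 1`. -/
theorem theta_weight_adjoint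
    (e f : Fin 3 → Matrix (Fin 2) (Fin 2) ℂ)
    (he : ∀ i, (e i).trace = 0) (hf : ∀ i, (f i).trace = 0)
    (hindep : LinearIndependent ℂ e)
    (hspan : ∀ X : Matrix (Fin 2) (Fin 2) ℂ, X.trace = 0 →
      X ∈ Submodule.span ℂ (Set.range e))
    (hdual : ∀ i j, (e i * f j).trace = if i = j then 1 else 0)
    (x y : Matrix (Fin 2) (Fin 2) ℂ) (hx : IsUnit x) (hy : IsUnit y) :
    ∑ i : Fin 3, ∑ j : Fin 3, ∑ k : Fin 3,
        ((e i * (x * e j * x⁻¹) - (x * e j * x⁻¹) * e i) * (y * e k * y⁻¹)).trace *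
          ((f k * f j - f j * f k) * f i).trace =
      2 * ((x.trace * (x⁻¹).trace - 1) * (y.trace * (y⁻¹).trace - 1) -
            ((x * y).trace * ((x * y)⁻¹).trace - 1)) := by
  have hP := sum_trace_mul_trace_of_dual hf hspan hdual
  have hT := sum_trace_mul_mul_mul_of_dual hf hspan hdual
  have hy1 : y * y⁻¹ = 1 := Matrix.mul_nonsing_inv y ((Matrix.isUnit_iff_isUnit_det y).1 hy)
  have hx1 : x * x⁻¹ = 1 := Matrix.mul_nonsing_inv x ((Matrix.isUnit_iff_isUnit_det x).1 hx)
  have sum_i (P Q F G : Matrix (Fin 2) (Fin 2) ℂ) :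
      ∑ i, ((e i * P - P * e i) * Q).trace * ((G * F - F * G) * f i).trace =
        ((P * Q - Q * P) * (G * F - F * G)).trace := by
    have h := hP (P * Q - Q * P) (G * F - F * G)
    rw [Matrix.trace_sub (P * Q), Matrix.trace_mul_comm P Q, sub_self, zero_mul, zero_div,
      sub_zero] at h
    rw [← h]
    refine Finset.sum_congr rfl fun i _ => ?_
    rw [Matrix.trace_mul_comm _ (f i), sub_mul, mul_sub (e i), Matrix.trace_sub, Matrix.trace_sub,
      mul_assoc, mul_assoc P, Matrix.trace_mul_comm P, mul_assoc (e i)]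
  have sum_k (P F : Matrix (Fin 2) (Fin 2) ℂ) :
      ∑ k, ((P * (y * e k * y⁻¹) - (y * e k * y⁻¹) * P) * (f k * F - F * f k)).trace =
        (y⁻¹).trace * (F * P * y).trace + y.trace * (y⁻¹ * P * F).trace
          - (y⁻¹ * F).trace * (P * y).trace - (y⁻¹ * P).trace * (F * y).trace := by
    have h (k) : ((P * (y * e k * y⁻¹) - (y * e k * y⁻¹) * P) * (f k * F - F * f k)).trace =
        (e k * y⁻¹ * f k * (F * P * y)).trace - (e k * (y⁻¹ * F) * f k * (P * y)).trace
          - (e k * (y⁻¹ * P) * f k * (F * y)).trace + (e k * (y⁻¹ * P * F) * f k * y).trace := by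
      simp only [Matrix.trace_fin_two, Matrix.mul_apply, Fin.sum_univ_two, Matrix.sub_apply]
      ring
    have hc (M N : Matrix (Fin 2) (Fin 2) ℂ) :
        (y⁻¹ * M * (N * y)).trace = (M * N).trace := by
      rw [Matrix.trace_mul_comm, mul_assoc, ← mul_assoc y, hy1, one_mul, Matrix.trace_mul_comm]
    simp only [h, Finset.sum_add_distrib, Finset.sum_sub_distrib, hT]
    rw [← mul_assoc y⁻¹ (F * P), mul_assoc (y⁻¹ * P) F y, ← mul_assoc y⁻¹ F P, hc, hc,
      mul_assoc (y⁻¹ * F) P y, hc]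
    ring
  have sum_j : ∑ j, ((y⁻¹).trace * (f j * (x * e j * x⁻¹) * y).trace
        + y.trace * (y⁻¹ * (x * e j * x⁻¹) * f j).trace
        - (y⁻¹ * f j).trace * ((x * e j * x⁻¹) * y).trace
        - (y⁻¹ * (x * e j * x⁻¹)).trace * (f j * y).trace) =
      (y⁻¹).trace * (x.trace * (x⁻¹ * y).trace) + y.trace * ((x⁻¹).trace * (y⁻¹ * x).trace)
        - (x⁻¹ * y * x * y⁻¹).trace - (x⁻¹ * y⁻¹ * x * y).trace := by
    have hc (M : Matrix (Fin 2) (Fin 2) ℂ) : (x⁻¹ * M * x).trace = M.trace := by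
      rw [Matrix.trace_mul_comm, ← mul_assoc, hx1, one_mul]
    have hc' (M : Matrix (Fin 2) (Fin 2) ℂ) : (x⁻¹ * (M * x)).trace = M.trace := by
      rw [← mul_assoc, hc]
    have h (j) : (y⁻¹).trace * (f j * (x * e j * x⁻¹) * y).trace
        + y.trace * (y⁻¹ * (x * e j * x⁻¹) * f j).trace
        - (y⁻¹ * f j).trace * ((x * e j * x⁻¹) * y).trace
        - (y⁻¹ * (x * e j * x⁻¹)).trace * (f j * y).trace =
        (y⁻¹).trace * (e j * (x⁻¹ * y) * f j * x).trace
        + y.trace * (e j * x⁻¹ * f j * (y⁻¹ * x)).trace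
        - (e j * (x⁻¹ * y * x)).trace * (f j * y⁻¹).trace
        - (e j * (x⁻¹ * y⁻¹ * x)).trace * (f j * y).trace := by
      simp only [Matrix.trace_fin_two, Matrix.mul_apply, Fin.sum_univ_two]
      ring
    simp only [h, Finset.sum_add_distrib, Finset.sum_sub_distrib, ← Finset.mul_sum, hT, hP, hc,
      hc']
    ring
  rw [← trace_mul_trace_inv_sub_trace_commutator x y hx hy, ← sum_j, Finset.sum_comm]
  refine Finset.sum_congr rfl fun j _ => ?_
  rw [Finset.sum_comm, ← sum_k]
  exact Finset.sum_congr rfl fun k _ => sum_i _ _ _ _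

end
end

section
/- Let α = (1+√5)/4 and β = (−1+√5)/4 (as real numbers, viewed in ℂ), and consider the 2×2 complex matrices A = [[i, 0], [0, −i]], B = [[1/2 − α·i, β], [−β, 1/2 + α·i]], C = [[α − (1/2)·i, −β·i], [−β·i, α + (1/2)·i]]. Then: (i) A, B, C each have determinant 1 and are unitary (the conjugate transpose equals the inverse), hence lie in SU(2); (ii) A² = −1, B³ = −1, C⁵ = −1 (where 1 denotes the 2×2 identity matrix); and (iii) A·B·C = 1. Consequently these matrices satisfy the defining relations (with h ↦ −1) of the presentation ⟨x₁, x₂, x₃, h | h central, x₁² = h, x₂³ = h⁻¹, x₃⁵ = h⁻¹, x₁x₂x₃ = 1⟩ of the fundamental group of the Poincaré homology sphere Σ(2,3,5). -/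
noncomputable section

/-- `α = (1+√5)/4`. -/
def α : ℂ := (((1 + Real.sqrt 5) / 4 : ℝ) : ℂ)

/-- `β = (−1+√5)/4`. -/
def β : ℂ := (((-1 + Real.sqrt 5) / 4 : ℝ) : ℂ)

/-- `A = ρ(x₁) = diag(i, −i)`. -/
def Aρ : Matrix (Fin 2) (Fin 2) ℂ := !![Complex.I, 0; 0, -Complex.I]

/-- `B = ρ(x₂)`. -/
def Bρ : Matrix (Fin 2) (Fin 2) ℂ :=
  !![1 / 2 - α * Complex.I, β; -β, 1 / 2 + α * Complex.I]

/-- `C = ρ(x₃)`. -/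
def Cρ : Matrix (Fin 2) (Fin 2) ℂ :=
  !![α - (1 / 2) * Complex.I, -β * Complex.I; -β * Complex.I, α + (1 / 2) * Complex.I]

theorem conj_α : (starRingEnd ℂ) α = α := Complex.conj_ofReal _

theorem conj_β : (starRingEnd ℂ) β = β := Complex.conj_ofReal _

theorem α_eq_β_add_half : α = β + 1 / 2 := by
  simp only [α, β]
  push_cast
  ring

theorem β_sq : β ^ 2 = 1 / 4 - β / 2 := by
  have h : ((Real.sqrt 5 : ℝ) : ℂ) ^ 2 = 5 := by
    exact_mod_cast Real.sq_sqrt (by norm_num : (0 : ℝ) ≤ 5)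
  simp only [β]
  push_cast
  linear_combination h / 16

theorem α_sq_add_β_sq : α ^ 2 + β ^ 2 = 3 / 4 := by
  rw [α_eq_β_add_half]
  linear_combination 2 * β_sq

/-- The Cayley–Hamilton theorem for a `2 × 2` matrix. -/
theorem Matrix.sq_eq_trace_smul_sub_det_smul_one {R : Type*} [CommRing R]
    (M : Matrix (Fin 2) (Fin 2) R) : M ^ 2 = M.trace • M - M.det • 1 := by
  ext i j
  fin_cases i <;> fin_cases j <;>
    simp [sq, Matrix.mul_apply, Fin.sum_univ_two, Matrix.trace_fin_two, Matrix.det_fin_two] <;>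
    ring

theorem Aρ_det : Aρ.det = 1 := by
  simp [Aρ, Matrix.det_fin_two]

theorem Bρ_det : Bρ.det = 1 := by
  simp only [Bρ, Matrix.det_fin_two_of]
  linear_combination α_sq_add_β_sq - α ^ 2 * Complex.I_sq

theorem Cρ_det : Cρ.det = 1 := by
  simp only [Cρ, Matrix.det_fin_two_of]
  linear_combination α_sq_add_β_sq - (1 / 4 + β ^ 2) * Complex.I_sq

theorem Aρ_mul_conjTranspose : Aρ * Aρ.conjTranspose = 1 := by
  ext i j
  fin_cases i <;> fin_cases j <;> simp [Aρ, Matrix.mul_apply]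

theorem Bρ_mul_conjTranspose : Bρ * Bρ.conjTranspose = 1 := by
  ext i j
  fin_cases i <;> fin_cases j <;>
    simp [Bρ, Matrix.mul_apply, Fin.sum_univ_two, conj_α, conj_β, map_ofNat]
  · linear_combination α_sq_add_β_sq - α ^ 2 * Complex.I_sq
  · ring
  · ring
  · linear_combination α_sq_add_β_sq - α ^ 2 * Complex.I_sq

theorem Cρ_mul_conjTranspose : Cρ * Cρ.conjTranspose = 1 := by
  ext i j
  fin_cases i <;> fin_cases j <;>
    simp [Cρ, Matrix.mul_apply, Fin.sum_univ_two, conj_α, conj_β, map_ofNat]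
  · linear_combination α_sq_add_β_sq - (1 / 4 + β ^ 2) * Complex.I_sq
  · ring
  · ring
  · linear_combination α_sq_add_β_sq - (1 / 4 + β ^ 2) * Complex.I_sq

theorem Aρ_sq : Aρ ^ 2 = -1 := by
  have ht : Aρ.trace = 0 := by simp [Aρ, Matrix.trace_fin_two]
  simp [Matrix.sq_eq_trace_smul_sub_det_smul_one, Aρ_det, ht]

theorem Bρ_pow_three : Bρ ^ 3 = -1 := by
  have ht : Bρ.trace = 1 := by
    simp only [Bρ, Matrix.trace_fin_two_of]
    ring
  have h : Bρ ^ 2 = Bρ - 1 := by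
    simp [Matrix.sq_eq_trace_smul_sub_det_smul_one, Bρ_det, ht]
  rw [pow_succ, h, sub_mul, ← sq, h]
  simp

theorem Cρ_pow_five : Cρ ^ 5 = -1 := by
  have ht : Cρ.trace = 2 * α := by
    simp only [Cρ, Matrix.trace_fin_two_of]
    ring
  have hα : (2 * α) * (2 * α) = 2 * α + 1 := by
    rw [α_eq_β_add_half]
    linear_combination 4 * β_sq
  have h2 : Cρ ^ 2 = (2 * α) • Cρ - 1 := by
    simp [Matrix.sq_eq_trace_smul_sub_det_smul_one, Cρ_det, ht]
  have h3 : Cρ ^ 3 = (2 * α) • Cρ - (2 * α) • 1 := by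
    rw [pow_succ, h2, sub_mul, one_mul, smul_mul_assoc, ← sq, h2, smul_sub, smul_smul, hα]
    module
  rw [show 5 = 3 + 2 from rfl, pow_add, h3, sub_mul, smul_mul_assoc, smul_mul_assoc, one_mul,
    ← pow_succ', h3, h2]
  simp only [smul_sub, smul_smul, hα]
  module

theorem Aρ_mul_Bρ_mul_Cρ : Aρ * Bρ * Cρ = 1 := by
  have h := α_sq_add_β_sq
  ext i j
  fin_cases i <;> fin_cases j <;>
    simp [Aρ, Bρ, Cρ, Matrix.mul_apply, Fin.sum_univ_two]
  all_goals grind [Complex.I_sq]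

/-- The matrices `A, B, C` lie in `SU(2)` (determinant 1 and unitary) and satisfy the
relations `A² = −1`, `B³ = −1`, `C⁵ = −1` and `A·B·C = 1`, i.e. the defining relations
(with `h = −1`) of the presentation of the fundamental group of the Poincaré homology
sphere `Σ(2,3,5)`. -/
theorem poincare_rep_relations :
    (Aρ.det = 1 ∧ Bρ.det = 1 ∧ Cρ.det = 1) ∧
    (Aρ * Aρ.conjTranspose = 1 ∧ Bρ * Bρ.conjTranspose = 1 ∧ Cρ * Cρ.conjTranspose = 1) ∧
    (Aρ ^ 2 = -1 ∧ Bρ ^ 3 = -1 ∧ Cρ ^ 5 = -1) ∧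
    Aρ * Bρ * Cρ = 1 := by
  exact ⟨⟨Aρ_det, Bρ_det, Cρ_det⟩,
    ⟨Aρ_mul_conjTranspose, Bρ_mul_conjTranspose, Cρ_mul_conjTranspose⟩,
    ⟨Aρ_sq, Bρ_pow_three, Cρ_pow_five⟩, Aρ_mul_Bρ_mul_Cρ⟩

end
end

section
/- Let α = (1+√5)/4 and β = (−1+√5)/4 (as real numbers, viewed in ℂ). Let g₁ = [[i, 0], [0, −i]] and g₂ = [[1/2 − α·i, β], [−β, 1/2 + α·i]], and for a 2×2 complex matrix g = [[a,b],[c,d]] and a polynomial f ∈ ℂ[X,Y] let g·f denote the polynomial obtained from f by substituting X ↦ aX + bY and Y ↦ cX + dY. If f ∈ ℂ[X,Y] is homogeneous of degree 4 and satisfies g₁·f = f and g₂·f = f, then f = 0. -/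
noncomputable section

/-- `g₁ = ρ(x₁) = diag(i, −i)`. -/
def g₁ : Matrix (Fin 2) (Fin 2) ℂ := !![Complex.I, 0; 0, -Complex.I]

/-- `g₂ = ρ(x₂)`. -/
def g₂ : Matrix (Fin 2) (Fin 2) ℂ :=
  !![1 / 2 - α * Complex.I, β; -β, 1 / 2 + α * Complex.I]

/-- The linear change-of-variables action of a 2×2 matrix `g` on polynomials in two
variables: substitute `X ↦ g₀₀·X + g₀₁·Y` and `Y ↦ g₁₀·X + g₁₁·Y`. -/
def matAct (g : Matrix (Fin 2) (Fin 2) ℂ) (f : MvPolynomial (Fin 2) ℂ) :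
    MvPolynomial (Fin 2) ℂ :=
  MvPolynomial.aeval
    (fun i => ∑ j : Fin 2, MvPolynomial.C (g i j) * MvPolynomial.X j) f

open MvPolynomial

/-- A binary form of degree `n` is the sum of its terms `c_{ij} X ^ i Y ^ j` with `i + j = n`. -/
theorem isHomogeneous_fin_two_eq_sum {R : Type*} [CommSemiring R] {n : ℕ}
    {f : MvPolynomial (Fin 2) R} (hf : f.IsHomogeneous n) :
    f = ∑ p ∈ Finset.HasAntidiagonal.antidiagonal n,
      C (f.coeff (Finsupp.single 0 p.1 + Finsupp.single 1 p.2)) * X 0 ^ p.1 * X 1 ^ p.2 := by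
  classical
  have hmon : ∀ p : ℕ × ℕ, ∀ c : R, C c * X 0 ^ p.1 * X 1 ^ p.2 =
      monomial (Finsupp.single (0 : Fin 2) p.1 + Finsupp.single 1 p.2) c := by
    intro p c
    rw [X_pow_eq_monomial, X_pow_eq_monomial, C_mul_monomial, monomial_mul, mul_one, mul_one]
  have hexp : ∀ m : Fin 2 →₀ ℕ, Finsupp.single 0 (m 0) + Finsupp.single 1 (m 1) = m := by
    intro m
    ext i
    fin_cases i <;> simp
  ext m
  simp only [hmon, coeff_sum, coeff_monomial]
  have hiff : ∀ p : ℕ × ℕ, Finsupp.single (0 : Fin 2) p.1 + Finsupp.single 1 p.2 = m ↔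
      p = (m 0, m 1) := by
    intro p
    constructor
    · rintro rfl
      ext <;> simp
    · rintro rfl
      exact hexp m
  simp only [hiff, Finset.sum_ite_eq', Finset.HasAntidiagonal.mem_antidiagonal, hexp]
  split_ifs with h
  · rfl
  · refine hf.coeff_eq_zero fun hm => h ?_
    rw [← hm, Finsupp.degree_eq_sum, Fin.sum_univ_two]

theorem eval_matAct (g : Matrix (Fin 2) (Fin 2) ℂ) (f : MvPolynomial (Fin 2) ℂ)
    (v : Fin 2 → ℂ) : eval v (matAct g f) = eval (g.mulVec v) f := by
  have h : (aeval v).comp (aeval fun i => ∑ j : Fin 2, C (g i j) * X j) =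
      (aeval (g.mulVec v) : MvPolynomial (Fin 2) ℂ →ₐ[ℂ] ℂ) := by
    ext i
    simp [Matrix.mulVec_eq_sum, mul_comm]
  exact DFunLike.congr_fun h f

/-- A quartic `a x⁴ + c x² y² + e y⁴` invariant under a matrix `[[p, q], [-q, r]]` of
determinant and trace one, with generic entries, vanishes. -/
theorem even_quartic_eq_zero_of_invariant {K : Type*} [Field K] {a c e p q r : K}
    (htr : p + r = 1) (hdet : p * r + q ^ 2 = 1) (hp : p ≠ 0) (hq : q ≠ 0) (hr : r ≠ 0)
    (hpr : p ≠ r) (hpq : p * r - q ^ 2 ≠ 0)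
    (h40 : a * p ^ 4 + c * p ^ 2 * q ^ 2 + e * q ^ 4 = a)
    (h31 : q * (2 * a * p ^ 3 - c * p * (p * r - q ^ 2) - 2 * e * q ^ 2 * r) = 0)
    (h13 : q * (2 * a * p * q ^ 2 + c * r * (p * r - q ^ 2) - 2 * e * r ^ 3) = 0)
    (h2 : (2 : K) ≠ 0) :
    a = 0 ∧ c = 0 ∧ e = 0 := by
  replace h31 := (mul_eq_zero.mp h31).resolve_left hq
  replace h13 := (mul_eq_zero.mp h13).resolve_left hq
  have he : a * p ^ 2 = e * r ^ 2 := by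
    refine mul_left_cancel₀ h2 ?_
    linear_combination r * h31 + p * h13 - 2 * (a * p ^ 2 - e * r ^ 2) * hdet
  have hc : c * r = 2 * a * p := by
    refine mul_left_cancel₀ (mul_ne_zero hp hpq) ?_
    linear_combination -r * h31 + 2 * q ^ 2 * he
  have ha : a = 0 := by
    have : a * (p - r) * (p + r) = 0 := by
      have h : r ^ 2 * (a * p ^ 4 + c * p ^ 2 * q ^ 2 + e * q ^ 4) = a * p ^ 2 := by
        linear_combination p ^ 2 * q ^ 2 * r * hc - q ^ 4 * he
          + a * p ^ 2 * (p * r + q ^ 2 + 1) * hdet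
      linear_combination r ^ 2 * h40 - h
    simpa [htr, sub_eq_zero, hpr] using this
  subst ha
  exact ⟨rfl, by simpa [hr] using hc, by simpa [hr] using he.symm⟩

/-- A binary form of degree 4 that is invariant under the substitution action of both
`ρ(x₁)` and `ρ(x₂)` is zero: the degree-4 part `V₄` of the binary-forms representation
has no nonzero vector fixed by both matrices. -/
theorem no_invariant_quartic (f : MvPolynomial (Fin 2) ℂ)
    (hhom : f.IsHomogeneous 4)
    (h1 : matAct g₁ f = f) (h2 : matAct g₂ f = f) :
    f = 0 := by
  obtain ⟨a, b, c, d, e, hf⟩ : ∃ a b c d e : ℂ, f = C a * X 0 ^ 4 + C b * X 0 ^ 3 * X 1 +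
      C c * X 0 ^ 2 * X 1 ^ 2 + C d * X 0 * X 1 ^ 3 + C e * X 1 ^ 4 := by
    let k : ℕ → ℕ → ℂ := fun i j => f.coeff (Finsupp.single 0 i + Finsupp.single 1 j)
    refine ⟨k 4 0, k 3 1, k 2 2, k 1 3, k 0 4, (isHomogeneous_fin_two_eq_sum hhom).trans ?_⟩
    rw [Finset.Nat.sum_antidiagonal_eq_sum_range_succ_mk]
    simp only [Finset.sum_range_succ, Finset.sum_range_zero, Nat.reduceSub, pow_zero, pow_one,
      mul_one]
    ring
  have hinv : ∀ g : Matrix (Fin 2) (Fin 2) ℂ, matAct g f = f → ∀ x y : ℂ,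
      eval ![g 0 0 * x + g 0 1 * y, g 1 0 * x + g 1 1 * y] f = eval ![x, y] f := by
    intro g hg x y
    conv_rhs => rw [← hg, eval_matAct]
    congr 2
    ext i
    fin_cases i <;> simp [Matrix.mulVec, dotProduct, Fin.sum_univ_two]
  have hI := Complex.I_sq
  have hI4 : Complex.I ^ 4 = 1 := Complex.I_pow_four
  have e1 : ∀ x y : ℂ, b * x ^ 3 * y + d * x * y ^ 3 = 0 := by
    intro x y
    have h := hinv g₁ h1 x y
    simp [hf, g₁] at h
    linear_combination -h / 2 + (a * x ^ 4 - b * x ^ 3 * y + c * x ^ 2 * y ^ 2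
      - d * x * y ^ 3 + e * y ^ 4) / 2 * hI4
  have hd : d = 0 := by linear_combination (e1 1 2 - 2 * e1 1 1) / 6
  have hb : b = 0 := by linear_combination e1 1 1 - hd
  subst hb hd
  have hs : ((√5 : ℝ) : ℂ) ^ 2 = 5 := by
    rw [← Complex.ofReal_pow, Real.sq_sqrt (by norm_num)]
    norm_num
  have hα : α = (1 + (√5 : ℝ)) / 4 := by simp [α]
  have hβ : β = (-1 + (√5 : ℝ)) / 4 := by simp [β]
  obtain ⟨p, hp⟩ : ∃ p, p = 1 / 2 - α * Complex.I := ⟨_, rfl⟩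
  obtain ⟨r, hr⟩ : ∃ r, r = 1 / 2 + α * Complex.I := ⟨_, rfl⟩
  have hdet : p * r + β ^ 2 = 1 := by
    rw [hp, hr, hα, hβ]
    linear_combination (-(1 + (√5 : ℝ)) ^ 2 / 16 : ℂ) * hI + hs / 8
  have hα0 : α ≠ 0 := by
    rw [α, Complex.ofReal_ne_zero]
    positivity
  have hβ0 : β ≠ 0 := by
    intro h
    rw [hβ] at h
    have : ((√5 : ℝ) : ℂ) = 1 := by linear_combination 4 * h
    rw [this] at hs
    norm_num at hs
  have hpq : p * r - β ^ 2 = α := by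
    rw [hp, hr, hα, hβ]
    linear_combination (-(1 + (√5 : ℝ)) ^ 2 / 16 : ℂ) * hI
  have hp0 : p ≠ 0 := by
    intro h
    have := congrArg Complex.re (hp.symm.trans h)
    simp [α] at this
  have hr0 : r ≠ 0 := by
    intro h
    have := congrArg Complex.re (hr.symm.trans h)
    simp [α] at this
  have hpr : p ≠ r := by
    intro h
    rw [hp, hr] at h
    exact mul_ne_zero hα0 Complex.I_ne_zero (by linear_combination -h / 2)
  have e2 : ∀ x y : ℂ, a * (p * x + β * y) ^ 4 + c * (p * x + β * y) ^ 2 * (-β * x + r * y) ^ 2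
      + e * (-β * x + r * y) ^ 4 = a * x ^ 4 + c * x ^ 2 * y ^ 2 + e * y ^ 4 := by
    intro x y
    have h := hinv g₂ h2 x y
    rw [hp, hr]
    simpa [hf, g₂] using h
  obtain ⟨rfl, rfl, rfl⟩ := even_quartic_eq_zero_of_invariant (a := a) (c := c) (e := e)
    (by rw [hp, hr]; ring) hdet hp0 hβ0 hr0 hpr (hpq ▸ hα0)
    (by linear_combination e2 1 0)
    (by linear_combination (8 * (e2 1 1 - e2 1 (-1)) - (e2 1 2 - e2 1 (-2))) / 24)
    (by linear_combination ((e2 1 2 - e2 1 (-2)) - 2 * (e2 1 1 - e2 1 (-1))) / 24) two_ne_zero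
  simpa using hf

end
end
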